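/- Let G = (ρ, V, w) be a rooted directed weighted graph with N ≥ 1 non-root nodes, L its spanning-tree Laplacian, and suppose det L ≠ 0; set B = (L^{-1})^T. Then for every non-root node j: ∑_{t∈T(G), (ρ,j)∈t} w(t) = (det L) · w_{ρj} · B_{jj}; and for all non-root nodes i ≠ j: ∑_{t∈T(G), (i,j)∈t} w(t) = (det L) · w_{ij} · (B_{jj} − B_{ij}). Equivalently, under the distribution p(t) = w(t)/Z on spanning trees with Z = det L, the marginal probability of an edge (i,j) is w_{ij}(B_{jj} − [i≠ρ]·B_{ij}), where [P] = 1 if P holds and 0 otherwise. -/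

import Mathlib

/-!
Nodes of a rooted directed weighted graph with `N` non-root nodes are encoded as
`Fin (N + 1)`, with the root `ρ` being `0` and the non-root nodes `1, …, N` being
`j.succ` for `j : Fin N`.  A candidate (spanning) tree is encoded by a parent
function `par : Fin N → Fin (N + 1)` assigning to each non-root node `j` the tail
of its unique incoming edge `(par j, j.succ)`.
-/

/-- One step upwards towards the root along the parent function (the root is a fixed point). -/
def Step {N : ℕ} (par : Fin N → Fin (N + 1)) : Fin (N + 1) → Fin (N + 1) :=
  fun v => if h : v = 0 then 0 else par (v.pred h)

/-- `par` encodes a directed spanning tree rooted at `0`: every node has exactly one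
incoming edge (built into the encoding) and there are no cycles, i.e. every node
reaches the root. -/
def IsSTree {N : ℕ} (par : Fin N → Fin (N + 1)) : Prop :=
  ∀ v : Fin (N + 1), (Step par)^[N] v = 0

instance {N : ℕ} (par : Fin N → Fin (N + 1)) : Decidable (IsSTree par) :=
  inferInstanceAs (Decidable (∀ v : Fin (N + 1), (Step par)^[N] v = 0))

/-- A dependency tree: a spanning tree with exactly one edge emanating from the root. -/
def IsDTree {N : ℕ} (par : Fin N → Fin (N + 1)) : Prop :=
  IsSTree par ∧ (Finset.univ.filter fun j : Fin N => par j = 0).card = 1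

instance {N : ℕ} (par : Fin N → Fin (N + 1)) : Decidable (IsDTree par) :=
  inferInstanceAs (Decidable (IsSTree par ∧
    (Finset.univ.filter fun j : Fin N => par j = 0).card = 1))

/-- The weight of a tree: the product of its edge weights. -/
def treeWeight {N : ℕ} (w : Fin (N + 1) → Fin (N + 1) → ℝ)
    (par : Fin N → Fin (N + 1)) : ℝ :=
  ∏ j : Fin N, w (par j) j.succ

/-- The spanning-tree Laplacian: rows/columns indexed by the non-root nodes
`1, …, N+1` (encoded as `Fin (N+1)`); the diagonal entry at `j` is the total incoming
weight `∑_{i' ∈ V ∖ {j}} w_{i'j}` (including `i' = ρ`). -/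
def stLap {N : ℕ} (w : Fin (N + 2) → Fin (N + 2) → ℝ) :
    Matrix (Fin (N + 1)) (Fin (N + 1)) ℝ :=
  Matrix.of fun i j =>
    if i = j then ∑ i' ∈ Finset.univ.erase j.succ, w i' j.succ
    else -w i.succ j.succ

/-- The standard basis vector of a non-root node, and the zero vector for the root. -/
def nodeVec {n : ℕ} (v : Fin (n + 1)) : Fin n → ℝ :=
  fun i => if i.succ = v then 1 else 0

/-- The adjacency matrix of a parent function, restricted to the non-root nodes. -/
def parentMatrix {n : ℕ} (par : Fin n → Fin (n + 1)) : Matrix (Fin n) (Fin n) ℝ :=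
  Matrix.of fun i j => nodeVec (par j) i

theorem nodeVec_succ {n : ℕ} (j : Fin n) : nodeVec j.succ = Pi.single j (1 : ℝ) := by
  ext i
  simp [nodeVec, Pi.single_apply]

theorem nodeVec_eq_zero_iff {n : ℕ} (v : Fin (n + 1)) : nodeVec v = 0 ↔ v = 0 := by
  refine ⟨fun h => ?_, ?_⟩
  · cases v using Fin.cases with
    | zero => rfl
    | succ j => simpa [nodeVec] using congrFun h j
  · rintro rfl
    ext i
    simp [nodeVec]

theorem parentMatrix_mulVec_nodeVec {n : ℕ} (par : Fin n → Fin (n + 1)) (v : Fin (n + 1)) :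
    (parentMatrix par).mulVec (nodeVec v) = nodeVec (Step par v) := by
  cases v using Fin.cases with
  | zero => simp [Step, (nodeVec_eq_zero_iff (0 : Fin (n + 1))).2 rfl]
  | succ j =>
    ext i
    simp [nodeVec_succ, Step, parentMatrix]

theorem parentMatrix_pow_mulVec_nodeVec {n : ℕ} (par : Fin n → Fin (n + 1)) (k : ℕ)
    (v : Fin (n + 1)) :
    (parentMatrix par ^ k).mulVec (nodeVec v) = nodeVec ((Step par)^[k] v) := by
  induction k generalizing v with
  | zero => simp
  | succ k ih =>
    rw [pow_succ, ← Matrix.mulVec_mulVec, parentMatrix_mulVec_nodeVec, ih,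
      Function.iterate_succ_apply]

theorem iterate_step_eq_zero_of_succ {n : ℕ} (par : Fin n → Fin (n + 1)) (v : Fin (n + 1))
    (h : (Step par)^[n + 1] v = 0) : (Step par)^[n] v = 0 := by
  have hker := Module.End.ker_pow_eq_ker_pow_finrank_of_le
    (f := Matrix.toLin' (parentMatrix par)) (m := n + 1) (by simp)
  have hmem : nodeVec v ∈ LinearMap.ker (Matrix.toLin' (parentMatrix par) ^ (n + 1)) := by
    rw [LinearMap.mem_ker, ← Matrix.toLin'_pow, Matrix.toLin'_apply,
      parentMatrix_pow_mulVec_nodeVec, h, nodeVec_eq_zero_iff]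
  rwa [hker, Module.finrank_fin_fun, LinearMap.mem_ker, ← Matrix.toLin'_pow,
    Matrix.toLin'_apply, parentMatrix_pow_mulVec_nodeVec, nodeVec_eq_zero_iff] at hmem

theorem det_one_sub_of_isNilpotent {n : ℕ} (A : Matrix (Fin n) (Fin n) ℝ)
    (h : IsNilpotent A) : (1 - A).det = 1 := by
  have hchar := (Matrix.isNilpotent_charpoly_sub_pow_of_isNilpotent h).eq_zero
  have heval := congrArg (Polynomial.eval 1) hchar
  simpa [Matrix.eval_charpoly, sub_eq_zero] using heval

theorem det_one_sub_parentMatrix {n : ℕ} (par : Fin n → Fin (n + 1)) :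
    (1 - parentMatrix par).det = if IsSTree par then 1 else 0 := by
  split_ifs with h
  · refine det_one_sub_of_isNilpotent _ ⟨n, ?_⟩
    refine Matrix.ext_of_mulVec_single fun j => ?_
    rw [← nodeVec_succ, parentMatrix_pow_mulVec_nodeVec, h, Matrix.zero_mulVec,
      nodeVec_eq_zero_iff]
  · obtain ⟨v, hv⟩ := not_forall.1 h
    let f : Fin (n + 1) → ℝ := fun u => if (Step par)^[n] u = 0 then 0 else 1
    have hf0 : f 0 = 0 := by
      have : (Step par)^[n] 0 = 0 := Function.iterate_fixed (by simp [Step]) n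
      simp [f, this]
    have hfs : ∀ u, f (Step par u) = f u := by
      intro u
      have : (Step par)^[n] (Step par u) = 0 ↔ (Step par)^[n] u = 0 := by
        rw [← Function.iterate_succ_apply]
        refine ⟨iterate_step_eq_zero_of_succ par u, fun hu => ?_⟩
        rw [Function.iterate_succ_apply', hu]
        simp [Step]
      simp [f, this]
    have hfn : ∀ u, ∑ i : Fin n, f i.succ * nodeVec u i = f u := by
      intro u
      cases u using Fin.cases with
      | zero => simp [hf0, (nodeVec_eq_zero_iff (0 : Fin (n + 1))).2 rfl]
      | succ j => simp [nodeVec]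
    rw [← Matrix.exists_vecMul_eq_zero_iff]
    refine ⟨fun i => f i.succ, fun hzero => ?_, ?_⟩
    · have : f v = 0 := by
        cases v using Fin.cases with
        | zero => exact hf0
        | succ j => exact congrFun hzero j
      simp [f, hv] at this
    · rw [Matrix.vecMul_sub, Matrix.vecMul_one, sub_eq_zero]
      ext j
      have := hfs j.succ
      simp only [Step, Fin.succ_ne_zero, dite_false, Fin.pred_succ] at this
      simp [Matrix.vecMul, dotProduct, parentMatrix, hfn, this]

theorem stLap_transpose_apply {N : ℕ} (w : Fin (N + 2) → Fin (N + 2) → ℝ) (j : Fin (N + 1)) :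
    (stLap w).transpose j = ∑ v, w v j.succ • (nodeVec j.succ - nodeVec v) := by
  ext i
  rw [Finset.sum_apply, ← Finset.sum_erase_add _ _ (Finset.mem_univ j.succ)]
  simp only [Matrix.transpose_apply, stLap, Matrix.of_apply, nodeVec, Pi.smul_apply,
    Pi.sub_apply, Fin.succ_inj, smul_eq_mul, sub_self, Pi.zero_apply,
    mul_zero, add_zero]
  split_ifs with h
  · subst h
    refine Finset.sum_congr rfl fun v hv => ?_
    rw [if_neg (Finset.ne_of_mem_erase hv).symm, sub_zero, mul_one]
  · rw [Finset.sum_eq_single i.succ]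
    · simp
    · intro v _ hv
      simp [hv.symm]
    · simp [h]

/-- The directed matrix-tree theorem. -/
theorem det_stLap {N : ℕ} (w : Fin (N + 2) → Fin (N + 2) → ℝ) :
    (stLap w).det
      = ∑ t : Fin (N + 1) → Fin (N + 2), if IsSTree t then treeWeight w t else 0 := by
  have hcols : (stLap w).transpose
      = fun j => ∑ v, w v j.succ • (nodeVec j.succ - nodeVec v) :=
    funext (stLap_transpose_apply w)
  rw [← Matrix.det_transpose, hcols]
  refine (Matrix.detRowAlternating.toMultilinearMap.map_sum _).trans ?_
  refine Finset.sum_congr rfl fun t _ => ?_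
  refine (MultilinearMap.map_smul_univ _ (fun j : Fin (N + 1) => w (t j) j.succ)
    (fun j => nodeVec j.succ - nodeVec (t j))).trans ?_
  have hdet : Matrix.det (fun j => nodeVec j.succ - nodeVec (t j))
      = if IsSTree t then 1 else 0 := by
    rw [← det_one_sub_parentMatrix, ← Matrix.det_transpose (1 - parentMatrix t)]
    congr 1
    ext j i
    simp [parentMatrix, nodeVec, Matrix.one_apply]
  change (∏ j, w (t j) j.succ) * Matrix.det (fun j => nodeVec j.succ - nodeVec (t j)) = _
  rw [hdet, mul_ite, mul_one, mul_zero, treeWeight]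

/-- The total weight of the spanning trees containing the edge `(v, j)` is the determinant of
the Laplacian with its `j`-th column replaced by the contribution of that edge. -/
theorem sum_treeWeight_eq_det_updateCol {N : ℕ} (w : Fin (N + 2) → Fin (N + 2) → ℝ)
    (v : Fin (N + 2)) (j : Fin (N + 1)) :
    (∑ t : Fin (N + 1) → Fin (N + 2), if IsSTree t ∧ t j = v then treeWeight w t else 0)
      = ((stLap w).updateCol j (w v j.succ • (nodeVec j.succ - nodeVec v))).det := by
  let w' : Fin (N + 2) → Fin (N + 2) → ℝ :=
    fun a b => if b = j.succ ∧ a ≠ v then 0 else w a b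
  have hlap : (stLap w).updateCol j (w v j.succ • (nodeVec j.succ - nodeVec v))
      = stLap w' := by
    refine Matrix.transpose_injective (funext fun k => ?_)
    rw [← Matrix.updateRow_transpose, stLap_transpose_apply]
    rcases eq_or_ne k j with rfl | hk
    · rw [Matrix.updateRow_self, Finset.sum_eq_single v]
      · simp [w']
      · intro u _ hu
        simp [w', hu]
      · simp
    · rw [Matrix.updateRow_ne hk, stLap_transpose_apply]
      simp [w', hk]
  rw [hlap, det_stLap]
  refine Finset.sum_congr rfl fun t _ => ?_
  rw [ite_and]
  refine if_congr Iff.rfl ?_ rfl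
  split_ifs with ht
  · refine Finset.prod_congr rfl fun k _ => (if_neg ?_).symm
    rintro ⟨hk, hne⟩
    exact hne (Fin.succ_injective _ hk ▸ ht)
  · symm
    exact Finset.prod_eq_zero (Finset.mem_univ j) (by simp [w', ht])

theorem sum_treeWeight_eq_det_mul {N : ℕ} (w : Fin (N + 2) → Fin (N + 2) → ℝ)
    (hdet : (stLap w).det ≠ 0) (v : Fin (N + 2)) (j : Fin (N + 1)) :
    (∑ t : Fin (N + 1) → Fin (N + 2), if IsSTree t ∧ t j = v then treeWeight w t else 0)
      = (stLap w).det * (w v j.succ *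
          (stLap w)⁻¹.mulVec (nodeVec j.succ - nodeVec v) j) := by
  rw [sum_treeWeight_eq_det_updateCol, ← Matrix.cramer_apply,
    ← Matrix.det_smul_inv_mulVec_eq_cramer _ _ hdet.isUnit, Matrix.mulVec_smul]
  simp

/-- edge marginals for spanning trees.
With `B = (L⁻¹)ᵀ` for the spanning-tree Laplacian `L` (assumed nonsingular):
for a root edge `(ρ, j)`, `∑_{t ∈ T(G), (ρ,j) ∈ t} w(t) = det L · w_{ρj} · B_{jj}`,
and for an edge `(i, j)` between distinct non-root nodes,
`∑_{t ∈ T(G), (i,j) ∈ t} w(t) = det L · w_{ij} · (B_{jj} − B_{ij})`; i.e. under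
`p(t) = w(t)/det L` the marginal of an edge `(i,j)` is
`w_{ij} (B_{jj} − [i ≠ ρ] B_{ij})`. -/
theorem stree_edge_marginals {N : ℕ}
    (w : Fin (N + 2) → Fin (N + 2) → ℝ) (hw : ∀ i j, 0 ≤ w i j)
    (hdet : (stLap w).det ≠ 0)
    (B : Matrix (Fin (N + 1)) (Fin (N + 1)) ℝ)
    (hB : B = (stLap w)⁻¹.transpose) :
    (∀ j : Fin (N + 1),
      (∑ t : Fin (N + 1) → Fin (N + 2),
          if IsSTree t ∧ t j = 0 then treeWeight w t else 0)
        = (stLap w).det * (w 0 j.succ * B j j))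
    ∧ ∀ i j : Fin (N + 1), i ≠ j →
      (∑ t : Fin (N + 1) → Fin (N + 2),
          if IsSTree t ∧ t j = i.succ then treeWeight w t else 0)
        = (stLap w).det * (w i.succ j.succ * (B j j - B i j)) := by
  subst hB
  refine ⟨fun j => ?_, fun i j _ => ?_⟩
  · rw [sum_treeWeight_eq_det_mul w hdet, (nodeVec_eq_zero_iff 0).2 rfl, sub_zero, nodeVec_succ]
    simp
  · rw [sum_treeWeight_eq_det_mul w hdet, Matrix.mulVec_sub, nodeVec_succ, nodeVec_succ]
    simp
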